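/- Let Γ be a non-bipartite (d+1)-colored graph such that every 3-residue of Γ is bipartite and every d-residue of Γ is either bipartite or non-bipartite with integer regular genus with respect to every cyclic permutation. Then ω_G(Γ) ≥ d!/2. -/

import Mathlib

open Relation

/-- An `n`-colored graph: a regular `n`-valent multigraph with a proper edge-coloring
by `Fin n`, encoded by one fixed-point-free "partner" involution per color. -/
structure CG (n : ℕ) where
  V : Type
  [finV : Fintype V]
  inv : Fin n → V → V
  invol : ∀ i v, inv i (inv i v) = v
  noFix : ∀ i v, inv i v ≠ v

attribute [instance] CG.finV

namespace CG

variable {n : ℕ}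

/-- `a` and `b` are joined by an edge whose color lies in `B`. -/
def step (G : CG n) (B : Set (Fin n)) (a b : G.V) : Prop := ∃ i ∈ B, G.inv i a = b

/-- `g_B`: the number of connected components of the subgraph spanned by the
edges with colors in `B`. -/
noncomputable def g (G : CG n) (B : Set (Fin n)) : ℕ :=
  Nat.card (Quotient (EqvGen.setoid (G.step B)))

def Connected (G : CG n) : Prop := ∀ a b : G.V, EqvGen (G.step Set.univ) a b

def Bipartite (G : CG n) : Prop := ∃ f : G.V → Bool, ∀ i v, f (G.inv i v) = ! f v

/-- The `B`-residue containing `v` is bipartite. -/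
def ResidueBipartite (G : CG n) (B : Set (Fin n)) (v : G.V) : Prop :=
  ∃ f : G.V → Bool, ∀ w, EqvGen (G.step B) v w → ∀ i ∈ B, f (G.inv i w) = ! f w

/-- Half the number of vertices, as a rational. -/
noncomputable def pQ (G : CG n) : ℚ := (Nat.card G.V : ℚ) / 2

/-- The regular genus of `G` with respect to the cyclic permutation `ε`:
`ρ_ε(Γ) = 1 - ½( Σ_j g_{ε_j ε_{j+1}} + (1-d)p )` where `n = d+1`. -/
noncomputable def rho [NeZero n] (G : CG n) (ε : ZMod n ≃ Fin n) : ℚ :=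
  1 - ((∑ j : ZMod n, (G.g {ε j, ε (j + 1)} : ℚ)) + (1 - ((n : ℚ) - 1)) * G.pQ) / 2

/-- The Gurau degree: the sum of `ρ_ε(Γ)` over all cyclic permutations of the colors
up to rotation and inversion; since `ρ_ε` is invariant under rotation and inversion of
`ε`, this is the sum over all `n!` labelings divided by `2n`. -/
noncomputable def omegaG [NeZero n] (G : CG n) : ℚ :=
  (∑ ε : ZMod n ≃ Fin n, G.rho ε) / (2 * n)

instance [NeZero n] : Nonempty (ZMod n ≃ Fin n) :=
  ⟨Fintype.equivOfCardEq (by simp [ZMod.card])⟩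

/-- The regular genus `ρ(Γ) = min_ε ρ_ε(Γ)`. -/
noncomputable def rhoMin [NeZero n] (G : CG n) : ℚ :=
  Finset.univ.inf' Finset.univ_nonempty (fun ε : ZMod n ≃ Fin n => G.rho ε)

/-- The residue (connected component) of the subgraph missing color `i` which
contains `v`, as an `n`-colored graph (colors renamed via `i.succAbove`). -/
noncomputable def hatRes (G : CG (n + 1)) (i : Fin (n + 1)) (v : G.V) : CG n where
  V := {w : G.V // EqvGen (G.step {j | j ≠ i}) v w}
  finV := Fintype.ofFinite _
  inv k w := ⟨G.inv (i.succAbove k) w.1,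
    (w.2.trans _ _ _ (EqvGen.rel _ _ ⟨i.succAbove k, Fin.succAbove_ne i k, rfl⟩))⟩
  invol := fun k w => Subtype.ext (G.invol _ _)
  noFix := fun k w h => G.noFix _ w.1 (congrArg Subtype.val h)

/-- `g_{î}`: the number of residues missing color `i`. -/
noncomputable def gHat (G : CG (n + 1)) (i : Fin (n + 1)) : ℕ := G.g {j | j ≠ i}

/-- `ω_G(Γ_{î})`: the sum of the Gurau degrees of the residues missing color `i`
(each component's degree is counted once: the contribution of each of its
vertices is divided by its cardinality). -/
noncomputable def omegaHat [NeZero n] (G : CG (n + 1)) (i : Fin (n + 1)) : ℚ :=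
  ∑ v : G.V, (G.hatRes i v).omegaG / (Nat.card (G.hatRes i v).V)

/-- `x`,`y` form a dipole of colors `C`: they are joined by edges of all colors in `C`
and lie in different components of the subgraph missing the colors of `C`. -/
def IsDipole (G : CG n) (C : Finset (Fin n)) (x y : G.V) : Prop :=
  (∀ c ∈ C, G.inv c x = y) ∧ ¬ EqvGen (G.step {j | j ∉ (C : Set (Fin n))}) x y

def HasDipole (G : CG n) (r : ℕ) : Prop :=
  ∃ C : Finset (Fin n), C.card = r ∧ ∃ x y, G.IsDipole C x y

/-- `G'` is obtained from `G` by eliminating the dipole `(C, x, y)`: the two vertices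
are deleted and the hanging edges are welded according to their colors. -/
def ElimDipole (G G' : CG n) (C : Finset (Fin n)) (x y : G.V) : Prop :=
  G.IsDipole C x y ∧ (∀ c ∉ C, G.inv c x ≠ y) ∧
  ∃ e : G'.V ≃ {v : G.V // v ≠ x ∧ v ≠ y},
    ∀ i w, (G.inv i (e w : G.V) = x → ((e (G'.inv i w)) : G.V) = G.inv i y) ∧
      (G.inv i (e w : G.V) = y → ((e (G'.inv i w)) : G.V) = G.inv i x) ∧
      (G.inv i (e w : G.V) ≠ x → G.inv i (e w : G.V) ≠ y →
        ((e (G'.inv i w)) : G.V) = G.inv i (e w : G.V))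

/-- Color-preserving isomorphism of colored graphs. -/
def Iso (G G' : CG n) : Prop :=
  ∃ e : G.V ≃ G'.V, ∀ i v, e (G.inv i v) = G'.inv i (e v)

/-- `G` is contracted (relative to a predicate recognizing the graphs that represent
the sphere): for every color `i` either `Γ_{î}` is connected or none of its
components represents a sphere. -/
def Contracted (G : CG (n + 1)) (IsSphereGraph : CG n → Prop) : Prop :=
  ∀ i : Fin (n + 1), G.gHat i = 1 ∨ ∀ v, ¬ IsSphereGraph (G.hatRes i v)

noncomputable def resSetoid (G : CG (n + 1)) (i : Fin (n + 1)) : Setoid G.V :=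
  EqvGen.setoid (G.step {j | j ≠ i})

/-- The number of singular residues missing color `i`. -/
noncomputable def singCount (G : CG (n + 1)) (IsSphereGraph : CG n → Prop)
    (i : Fin (n + 1)) : ℕ :=
  Nat.card {x : Quotient (G.resSetoid i) // ¬ IsSphereGraph (G.hatRes i x.out)}

/-- Color `i` is singular: some residue missing color `i` is not a sphere. -/
def SingColor (G : CG (n + 1)) (IsSphereGraph : CG n → Prop) (i : Fin (n + 1)) : Prop :=
  ∃ v, ¬ IsSphereGraph (G.hatRes i v)

end CG

namespace CG

variable {n : ℕ}

theorem anti_zero (G : CG n) (hG : G.Connected) (hnb : ¬ G.Bipartite) (y : G.V → ℚ)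
    (hy : ∀ i v, y (G.inv i v) = - y v) : ∀ v, y v = 0 := by
  by_contra! h
  obtain ⟨v0, h0⟩ := h
  have key : ∀ a b, EqvGen (G.step Set.univ) a b → (y a = 0 ↔ y b = 0) := by
    intro a b hab
    induction hab with
    | rel a b h =>
      obtain ⟨i, -, rfl⟩ := h
      rw [hy]; simp
    | refl a => rfl
    | symm a b _ ih => exact ih.symm
    | trans a b c _ _ ih1 ih2 => exact ih1.trans ih2
  have hne : ∀ v, y v ≠ 0 := fun v hv => h0 ((key v v0 (hG v v0)).1 hv)
  apply hnb
  refine ⟨fun v => decide (0 < y v), fun i v => ?_⟩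
  beta_reduce
  rw [hy]
  rcases lt_or_gt_of_ne (hne v) with h | h
  · simp [h, h.le]
  · simp [h, h.le]

/-- sign of a boolean -/
def sg (b : Bool) : ℚ := if b then 1 else -1

theorem sg_not (b : Bool) : sg (!b) = - sg b := by cases b <;> simp [sg]

theorem sg_ne (b : Bool) : sg b ≠ 0 := by cases b <;> simp [sg]

theorem card_black (G : CG n) (s : G.V → Bool) (a : Fin n)
    (hs : ∀ v, s (G.inv a v) = ! s v) :
    2 * Nat.card {v // s v = true} = Nat.card G.V := by
  classical
  have e : {v // s v = true} ≃ {v // ¬ s v = true} :=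
    { toFun := fun v => ⟨G.inv a v.1, by rw [hs, v.2]; simp⟩
      invFun := fun v => ⟨G.inv a v.1, by rw [hs]; simpa using v.2⟩
      left_inv := fun v => Subtype.ext (G.invol _ _)
      right_inv := fun v => Subtype.ext (G.invol _ _) }
  have h := Nat.card_congr (Equiv.sumCompl (fun v : G.V => s v = true))
  rw [Nat.card_sum, ← Nat.card_congr e] at h
  omega

theorem face_bound [NeZero n] (G : CG n) (hG : G.Connected) (hnb : ¬ G.Bipartite)
    (e : ZMod n → Fin n) (he : Function.Surjective e)
    (s : ZMod n → G.V → Bool)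
    (h1 : ∀ j v, s j (G.inv (e j) v) = ! s j v)
    (h2 : ∀ j v, s j (G.inv (e (j + 1)) v) = ! s j v) :
    2 * ∑ j : ZMod n, G.g {e j, e (j + 1)} + 2 * Nat.card G.V ≤ n * Nat.card G.V + 2 := by
  classical
  let Q : ZMod n → Type := fun j => Quotient (EqvGen.setoid (G.step {e j, e (j + 1)}))
  have hv0 : Nonempty G.V := by
    by_contra hc
    exact hnb ⟨fun _ => true, fun i v => (hc ⟨v⟩).elim⟩
  obtain ⟨v0⟩ := hv0
  have : ∀ j, Fintype (Q j) := fun j => Fintype.ofFinite _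
  let M : Submodule ℚ (ZMod n → G.V → ℚ) :=
    { carrier := {x | ∀ j v, x j (G.inv (e j) v) = - x j v}
      add_mem' := by
        intro x y hx hy j v
        simp only [Pi.add_apply, hx j v, hy j v]; ring
      zero_mem' := by intro j v; simp
      smul_mem' := by
        intro c x hx j v
        simp only [Pi.smul_apply, hx j v, smul_eq_mul]; ring }
  let f : M →ₗ[ℚ] (G.V → ℚ) :=
    { toFun := fun x v => ∑ j, x.1 j v
      map_add' := by intro x y; ext v; simp [Finset.sum_add_distrib]
      map_smul' := by intro c x; ext v; simp [Finset.mul_sum] }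
  let Y : ((j : ZMod n) → Q j → ℚ) → ZMod n → G.V → ℚ :=
    fun φ j v => sg (s j v) * φ j (Quotient.mk _ v)
  have hY1 : ∀ φ j v, Y φ j (G.inv (e j) v) = - Y φ j v := by
    intro φ j v
    have : (Quotient.mk _ (G.inv (e j) v) : Q j) = Quotient.mk _ v :=
      Quotient.sound (EqvGen.symm _ _ (EqvGen.rel _ _ ⟨e j, by simp, rfl⟩))
    simp only [Y, h1, sg_not, this]; ring
  have hY2 : ∀ φ j v, Y φ j (G.inv (e (j + 1)) v) = - Y φ j v := by
    intro φ j v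
    have : (Quotient.mk _ (G.inv (e (j + 1)) v) : Q j) = Quotient.mk _ v :=
      Quotient.sound (EqvGen.symm _ _ (EqvGen.rel _ _ ⟨e (j + 1), by simp, rfl⟩))
    simp only [Y, h2, sg_not, this]; ring
  have hY2' : ∀ φ j v, Y φ (j - 1) (G.inv (e j) v) = - Y φ (j - 1) v := by
    intro φ j v
    have := hY2 φ (j - 1) v
    rwa [sub_add_cancel] at this
  let D : ((j : ZMod n) → Q j → ℚ) →ₗ[ℚ] LinearMap.ker f :=
    { toFun := fun φ => ⟨⟨fun j v => Y φ j v - Y φ (j - 1) v, by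
          intro j v
          simp only [hY1, hY2']; ring⟩, by
          rw [LinearMap.mem_ker]
          ext v
          simp only [f, LinearMap.coe_mk, AddHom.coe_mk, Finset.sum_sub_distrib, Pi.zero_apply]
          rw [sub_eq_zero]
          exact (Equiv.sum_comp (Equiv.subRight (1 : ZMod n)) (fun j => Y φ j v)).symm⟩
      map_add' := by
        intro x y
        apply Subtype.ext; apply Subtype.ext
        ext j v
        simp only [Y, Pi.add_apply, Submodule.coe_add]; ring
      map_smul' := by
        intro c x
        apply Subtype.ext; apply Subtype.ext
        ext j v
        simp only [Y, Pi.smul_apply, Submodule.coe_smul, smul_eq_mul, RingHom.id_apply]; ring }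
  have hD : Function.Injective D := by
    rw [injective_iff_map_eq_zero]
    intro φ hφ
    have hc : ∀ j v, Y φ j v = Y φ (j - 1) v := by
      intro j v
      have := congrFun (congrFun (congrArg (fun x => x.1.1) hφ) j) v
      simp only [D, LinearMap.coe_mk, AddHom.coe_mk] at this
      exact sub_eq_zero.1 this
    have hk : ∀ (k : ℕ) v, Y φ (k : ZMod n) v = Y φ 0 v := by
      intro k
      induction k with
      | zero => intro v; simp
      | succ k ih =>
        intro v
        rw [hc]
        push_cast
        rw [add_sub_cancel_right, ih]
    have hk' : ∀ j v, Y φ j v = Y φ 0 v := by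
      intro j v
      have := hk j.val v
      rwa [ZMod.natCast_zmod_val] at this
    have h0 : ∀ v, Y φ 0 v = 0 := by
      apply anti_zero G hG hnb
      intro i v
      obtain ⟨j, rfl⟩ := he i
      rw [← hk' j, ← hk' j, hY1]
    ext j q
    obtain ⟨v, rfl⟩ := Quotient.exists_rep q
    have := hk' j v
    rw [h0] at this
    exact (mul_eq_zero.1 this).resolve_left (sg_ne _)
  have r1 := LinearMap.finrank_le_finrank_of_injective hD
  have r2 : Module.finrank ℚ ((j : ZMod n) → Q j → ℚ) = ∑ j : ZMod n, G.g {e j, e (j + 1)} := by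
    rw [Module.finrank_pi_fintype]
    apply Finset.sum_congr rfl
    intro j _
    rw [Module.finrank_pi, ← Nat.card_eq_fintype_card]
    rfl
  have r3 := LinearMap.finrank_range_add_finrank_ker f
  -- dimension of M
  let R : M →ₗ[ℚ] ((j : ZMod n) → {v // s j v = true} → ℚ) :=
    { toFun := fun x j v => x.1 j v.1
      map_add' := by intro x y; rfl
      map_smul' := by intro c x; rfl }
  have hR : Function.Injective R := by
    rw [injective_iff_map_eq_zero]
    intro x hx
    have hb : ∀ j v, s j v = true → x.1 j v = 0 := by
      intro j v hv
      exact congrFun (congrFun hx j) ⟨v, hv⟩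
    apply Subtype.ext
    ext j v
    cases hv : s j v with
    | true => exact hb j v hv
    | false =>
      have h := hb j (G.inv (e j) v) (by rw [h1, hv]; rfl)
      rw [x.2 j v] at h
      simpa using h
  have r4 := LinearMap.finrank_le_finrank_of_injective hR
  have r5 : 2 * Module.finrank ℚ ((j : ZMod n) → {v // s j v = true} → ℚ) = n * Nat.card G.V := by
    rw [Module.finrank_pi_fintype, Finset.mul_sum]
    rw [Finset.sum_congr rfl (g := fun _ => Nat.card G.V)]
    · simp [ZMod.card]
    · intro j _
      rw [Module.finrank_pi, ← Nat.card_eq_fintype_card]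
      exact card_black G (s j) (e j) (h1 j)
  -- dimension of the range
  have hedge : ∀ i v, (Pi.single v 1 - Pi.single (G.inv i v) 1 : G.V → ℚ) ∈ LinearMap.range f := by
    intro i v
    obtain ⟨j, rfl⟩ := he i
    refine ⟨⟨Pi.single j (Pi.single v 1 - Pi.single (G.inv (e j) v) 1), ?_⟩, ?_⟩
    · intro k w
      by_cases hkj : k = j
      · subst hkj
        have hA : (G.inv (e k) w = v) ↔ (w = G.inv (e k) v) :=
          ⟨fun h => by rw [← h, G.invol], fun h => by rw [h, G.invol]⟩
        have hB : (G.inv (e k) w = G.inv (e k) v) ↔ (w = v) :=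
          ⟨fun h => by rw [← G.invol (e k) w, h, G.invol], fun h => by rw [h]⟩
        simp only [Pi.single_eq_same, Pi.sub_apply, Pi.single_apply, hA, hB]
        ring
      · simp [Pi.single_eq_of_ne hkj]
    · ext w
      simp only [f, LinearMap.coe_mk, AddHom.coe_mk]
      rw [Finset.sum_eq_single j]
      · simp
      · intro k _ hk
        simp [Pi.single_eq_of_ne hk]
      · simp
  have hconn : ∀ a b, EqvGen (G.step Set.univ) a b →
      (Pi.single a 1 - Pi.single b 1 : G.V → ℚ) ∈ LinearMap.range f := by
    intro a b hab
    induction hab with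
    | rel a b h =>
      obtain ⟨i, -, rfl⟩ := h
      exact hedge i a
    | refl a => simp
    | symm a b _ ih => rw [← neg_sub]; exact Submodule.neg_mem _ ih
    | trans a b c _ _ ih1 ih2 =>
      have := Submodule.add_mem _ ih1 ih2
      rwa [sub_add_sub_cancel] at this
  have htop : LinearMap.range f ⊔ Submodule.span ℚ {(Pi.single v0 1 : G.V → ℚ)} = ⊤ := by
    rw [eq_top_iff, ← (Pi.basisFun ℚ G.V).span_eq, Submodule.span_le]
    rintro _ ⟨v, rfl⟩
    rw [Pi.basisFun_apply, ← sub_add_cancel (Pi.single v 1 : G.V → ℚ) (Pi.single v0 1)]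
    exact Submodule.add_mem_sup (hconn v v0 (hG v v0)) (Submodule.mem_span_singleton_self _)
  have r6 := Submodule.finrank_add_le_finrank_add_finrank (LinearMap.range f)
    (Submodule.span ℚ {(Pi.single v0 1 : G.V → ℚ)})
  rw [htop, finrank_top, Module.finrank_pi, ← Nat.card_eq_fintype_card] at r6
  have r7 := finrank_span_le_card (R := ℚ) ({(Pi.single v0 1 : G.V → ℚ)} : Set (G.V → ℚ))
  simp only [Set.toFinset_singleton, Finset.card_singleton] at r7
  rw [r2] at r1
  omega

end CG

namespace CG

theorem card_sameCycle {α : Type*} [Fintype α] [DecidableEq α] (σ : Equiv.Perm α) :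
    Nat.card (Quotient (Equiv.Perm.SameCycle.setoid σ)) =
      σ.cycleFactorsFinset.card + (Finset.univ.filter (fun v => σ v = v)).card := by
  let F : α → (Equiv.Perm α) ⊕ α := fun v => if σ v = v then Sum.inr v else Sum.inl (σ.cycleOf v)
  have hF : ∀ v w, F v = F w ↔ σ.SameCycle v w := by
    intro v w
    by_cases hv : σ v = v
    · have h1 : σ.SameCycle v w ↔ v = w := by
        constructor
        · rintro ⟨k, hk⟩
          rw [← hk, Equiv.Perm.zpow_apply_eq_self_of_apply_eq_self hv]
        · rintro rfl; exact Equiv.Perm.SameCycle.refl _ _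
      rw [h1]
      by_cases hw : σ w = w
      · simp [F, hv, hw]
      · simp only [F, hv, hw, if_true, if_false]
        constructor
        · intro h; simp at h
        · rintro rfl; exact absurd hv hw
    · by_cases hw : σ w = w
      · simp only [F, hv, hw, if_true, if_false]
        constructor
        · intro h; simp at h
        · intro h
          exact absurd ((Equiv.Perm.SameCycle.apply_eq_self_iff h).2 hw) hv
      · simp only [F, hv, hw, if_false, Sum.inl.injEq]
        exact (Equiv.Perm.sameCycle_iff_cycleOf_eq_of_mem_support
          (by simpa using hv) (by simpa using hw)).symm
  have hs : Equiv.Perm.SameCycle.setoid σ = Setoid.ker F := by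
    ext v w
    exact (hF v w).symm
  rw [hs, Nat.card_congr (Setoid.quotientKerEquivRange F)]
  have hr : Set.range F = ((σ.cycleFactorsFinset.disjSum
      (Finset.univ.filter (fun v => σ v = v)) : Finset _) : Set ((Equiv.Perm α) ⊕ α)) := by
    ext x
    rw [Finset.mem_coe, Finset.mem_disjSum]
    constructor
    · rintro ⟨v, rfl⟩
      by_cases hv : σ v = v
      · right; exact ⟨v, by simpa using hv, by simp [F, hv]⟩
      · left
        exact ⟨σ.cycleOf v, Equiv.Perm.cycleOf_mem_cycleFactorsFinset_iff.2 (by simpa using hv),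
          by simp [F, hv]⟩
    · rintro (⟨c, hc, rfl⟩ | ⟨v, hv, rfl⟩)
      · obtain ⟨a, ha⟩ := (Equiv.Perm.mem_cycleFactorsFinset_iff.1 hc).1.nonempty_support
        have h := Equiv.Perm.cycle_is_cycleOf ha hc
        have ha' := Equiv.Perm.mem_cycleFactorsFinset_support_le hc ha
        refine ⟨a, ?_⟩
        rw [Equiv.Perm.mem_support] at ha'
        simp [F, ha', ← h]
      · refine ⟨v, ?_⟩
        simp only [Finset.mem_filter, Finset.mem_univ, true_and] at hv
        simp [F, hv]
  rw [hr, Nat.card_coe_set_eq, Set.ncard_coe_finset, Finset.card_disjSum]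

theorem sign_eq {α : Type*} [Fintype α] [DecidableEq α] (σ : Equiv.Perm α) :
    Equiv.Perm.sign σ =
      (-1) ^ (Nat.card α + Nat.card (Quotient (Equiv.Perm.SameCycle.setoid σ))) := by
  rw [card_sameCycle, Equiv.Perm.sign_of_cycleType, Equiv.Perm.sum_cycleType]
  have h1 : σ.cycleType.card = σ.cycleFactorsFinset.card := by
    simp [Equiv.Perm.cycleType_def]
  have h2 : σ.support.card + (Finset.univ.filter (fun v => σ v = v)).card = Nat.card α := by
    rw [Nat.card_eq_fintype_card, ← Finset.card_univ,
      ← Finset.card_filter_add_card_filter_not (s := Finset.univ) (fun v => σ v = v), add_comm]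
    congr 1
  rw [h1, ← h2]
  set a := (Finset.univ.filter (fun v => σ v = v)).card
  have : σ.support.card + a + (σ.cycleFactorsFinset.card + a) =
    σ.support.card + σ.cycleFactorsFinset.card + 2 * a := by ring
  rw [this, pow_add _ _ (2 * a), pow_mul]
  simp

variable {n : ℕ}

/-- The permutation `inv b ∘ inv a` of the black vertices. -/
def bp (G : CG n) (s : G.V → Bool) (a b : Fin n) (ha : ∀ v, s (G.inv a v) = ! s v)
    (hb : ∀ v, s (G.inv b v) = ! s v) : Equiv.Perm {v // s v = true} where
  toFun v := ⟨G.inv b (G.inv a v.1), by rw [hb, ha, v.2]; rfl⟩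
  invFun v := ⟨G.inv a (G.inv b v.1), by rw [ha, hb, v.2]; rfl⟩
  left_inv v := Subtype.ext (by simp [G.invol])
  right_inv v := Subtype.ext (by simp [G.invol])

theorem card_bp (G : CG n) (s : G.V → Bool) (a b : Fin n) (ha : ∀ v, s (G.inv a v) = ! s v)
    (hb : ∀ v, s (G.inv b v) = ! s v) :
    Nat.card (Quotient (Equiv.Perm.SameCycle.setoid (bp G s a b ha hb))) = G.g {a, b} := by
  classical
  set σ := bp G s a b ha hb with hσ
  let r : G.V → {v // s v = true} := fun v =>
    if h : s v = true then ⟨v, h⟩ else ⟨G.inv a v, by rw [ha]; simpa using h⟩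
  have hra : ∀ v, r (G.inv a v) = r v := by
    intro v
    cases hv : s v <;> simp [r, ha, hv, G.invol]
  have hrb : ∀ v, σ.SameCycle (r v) (r (G.inv b v)) := by
    intro v
    cases hv : s v with
    | false =>
      have : r (G.inv b v) = σ (r v) := by
        simp [r, hb, hv, hσ, bp, G.invol]
      rw [this]
      exact (Equiv.Perm.SameCycle.refl _ _).apply_right
    | true =>
      have : r v = σ (r (G.inv b v)) := by
        simp [r, hb, hv, hσ, bp, G.invol]
      rw [this]
      exact (Equiv.Perm.SameCycle.refl _ _).apply_left
  have hr : ∀ u v, EqvGen (G.step {a, b}) u v → σ.SameCycle (r u) (r v) := by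
    intro u v h
    induction h with
    | rel u v h =>
      obtain ⟨i, hi, rfl⟩ := h
      rcases hi with rfl | hi
      · rw [hra]
      · rw [Set.mem_singleton_iff] at hi
        subst hi
        exact hrb u
    | refl a => exact Equiv.Perm.SameCycle.refl _ _
    | symm a b _ ih => exact ih.symm
    | trans a b c _ _ ih1 ih2 => exact ih1.trans ih2
  have hrs : ∀ v : {v // s v = true}, r v.1 = v := by
    intro v; simp [r, v.2]
  have hrr : ∀ v, EqvGen (G.step {a, b}) (r v).1 v := by
    intro v
    by_cases hv : s v = true
    · simp only [r, hv, dif_pos]; exact EqvGen.refl _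
    · simp only [r, hv, dif_neg]
      exact EqvGen.symm _ _ (EqvGen.rel _ _ ⟨a, by simp, by simp⟩)
  have hback : ∀ u v : {v // s v = true}, σ.SameCycle u v → EqvGen (G.step {a, b}) u.1 v.1 := by
    intro u v h
    obtain ⟨k, -, rfl⟩ := h.exists_pow_eq'
    induction k with
    | zero => exact EqvGen.refl _
    | succ k ih =>
      refine EqvGen.trans _ _ _ (ih ⟨k, by simp⟩) ?_
      rw [pow_succ']
      refine EqvGen.trans _ (G.inv a ((σ ^ k) u).1) _ ?_ ?_
      · exact EqvGen.rel _ _ ⟨a, by simp, rfl⟩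
      · exact EqvGen.rel _ _ ⟨b, by simp, rfl⟩
  apply Nat.card_congr
  exact
    { toFun := Quotient.map' (fun v => v.1) hback
      invFun := Quotient.map' r hr
      left_inv := by
        intro q
        induction q using Quotient.inductionOn with
        | h v => exact congrArg (Quotient.mk _) (hrs v)
      right_inv := by
        intro q
        induction q using Quotient.inductionOn with
        | h v => exact Quotient.sound (hrr v) }

theorem triangle (G : CG n) (s : G.V → Bool) (a b c : Fin n) (ha : ∀ v, s (G.inv a v) = ! s v)
    (hb : ∀ v, s (G.inv b v) = ! s v) (hc : ∀ v, s (G.inv c v) = ! s v) :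
    Even (G.g {a, b} + G.g {b, c} + G.g {c, a} + 3 * Nat.card {v // s v = true}) := by
  classical
  have h : bp G s c a hc ha * (bp G s b c hb hc * bp G s a b ha hb) = 1 := by
    ext v
    simp [bp, G.invol]
  have h2 := congrArg Equiv.Perm.sign h
  rw [map_mul, map_mul, sign_eq, sign_eq, sign_eq, card_bp, card_bp, card_bp, map_one, ← pow_add,
    ← pow_add] at h2
  have h3 := (neg_one_pow_eq_one_iff_even (R := ℤˣ) (by decide)).1 h2
  convert h3 using 1
  ring

/-- A two-colored graph is bipartite. -/
theorem bip_two (G : CG 2) (hG : G.Connected) : G.Bipartite := by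
  classical
  by_cases hne : Nonempty G.V
  swap
  · exact ⟨fun _ => true, fun i v => (hne ⟨v⟩).elim⟩
  obtain ⟨v0⟩ := hne
  let A : Equiv.Perm G.V := ⟨G.inv 0, G.inv 0, G.invol 0, G.invol 0⟩
  let B : Equiv.Perm G.V := ⟨G.inv 1, G.inv 1, G.invol 1, G.invol 1⟩
  have hAA : A * A = 1 := by ext v; exact G.invol 0 v
  have hBB : B * B = 1 := by ext v; exact G.invol 1 v
  have hA' : A⁻¹ = A := inv_eq_of_mul_eq_one_left hAA
  have hB' : B⁻¹ = B := inv_eq_of_mul_eq_one_left hBB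
  set σ := B * A with hσ
  have hcj : A * σ * A⁻¹ = σ⁻¹ := by
    rw [hσ, mul_inv_rev, hA', hB', mul_assoc, mul_assoc, hAA, mul_one]
  have hcz : ∀ k : ℤ, A * σ ^ k = σ ^ (-k) * A := by
    intro k
    have : (A * σ * A⁻¹) ^ k = A * σ ^ k * A⁻¹ := conj_zpow
    rw [hcj, inv_zpow', ] at this
    rw [this]; group
  have hcz' : ∀ (k : ℤ) v, A ((σ ^ k) v) = (σ ^ (-k)) (A v) := fun k v =>
    congrFun (congrArg DFunLike.coe (hcz k)) v
  have hno : ∀ v, ¬ σ.SameCycle v (A v) := by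
    rintro v ⟨k, hk⟩
    rcases Int.even_or_odd' k with ⟨m, rfl | rfl⟩
    · apply G.noFix 0 ((σ ^ m) v)
      change A ((σ ^ m) v) = (σ ^ m) v
      rw [hcz', ← hk, ← Equiv.Perm.mul_apply, ← zpow_add]
      congr 2; ring
    · apply G.noFix 1 (A ((σ ^ m) v))
      change σ ((σ ^ m) v) = A ((σ ^ m) v)
      rw [hcz', ← hk, ← Equiv.Perm.mul_apply, ← Equiv.Perm.mul_apply, ← zpow_add, ← zpow_one_add]
      congr 2; ring
  have hBs : ∀ v, σ.SameCycle (A v) (B v) := by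
    intro v
    refine ⟨1, ?_⟩
    change B (A (A v)) = B v
    congr 1
    exact G.invol 0 v
  have hAp : ∀ u v, σ.SameCycle u v → σ.SameCycle (A u) (A v) := by
    rintro u v ⟨k, rfl⟩
    exact ⟨-k, (hcz' k u).symm⟩
  have hAAv : ∀ v, A (A v) = v := G.invol 0
  have hcov : ∀ u v, EqvGen (G.step Set.univ) u v → (σ.SameCycle u v ∨ σ.SameCycle u (A v)) := by
    intro u v h
    induction h with
    | rel u v h =>
      obtain ⟨i, -, rfl⟩ := h
      right
      fin_cases i
      · change σ.SameCycle u (A (A u))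
        rw [hAAv]
      · change σ.SameCycle u (A (B u))
        have := hAp _ _ (hBs u)
        rwa [hAAv] at this
    | refl a => left; exact Equiv.Perm.SameCycle.refl _ _
    | symm a b _ ih =>
      rcases ih with h | h
      · exact Or.inl h.symm
      · right
        have := hAp _ _ h.symm
        rwa [hAAv] at this
    | trans a b c _ _ ih1 ih2 =>
      rcases ih1 with h1 | h1 <;> rcases ih2 with h2 | h2
      · exact Or.inl (h1.trans h2)
      · exact Or.inr (h1.trans h2)
      · exact Or.inr (h1.trans (hAp _ _ h2))
      · left
        have := hAp _ _ h2
        rw [hAAv] at this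
        exact h1.trans this
  have hfA : ∀ v, σ.SameCycle v0 (A v) ↔ ¬ σ.SameCycle v0 v := by
    intro v
    constructor
    · intro h h'
      exact hno v (h'.symm.trans h)
    · intro h
      exact (hcov v0 v (hG v0 v)).resolve_left h
  refine ⟨fun v => decide (σ.SameCycle v0 v), fun i v => ?_⟩
  have key : σ.SameCycle v0 (G.inv i v) ↔ ¬ σ.SameCycle v0 v := by
    rw [← hfA]
    fin_cases i
    · rfl
    · exact ⟨fun h => h.trans (hBs v).symm, fun h => h.trans (hBs v)⟩
  simp [key]

/-- Gluing local bipartitions of residues. -/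
theorem glue (G : CG n) (B : Set (Fin n)) (h : ∀ v, G.ResidueBipartite B v) :
    ∃ s : G.V → Bool, ∀ i ∈ B, ∀ v, s (G.inv i v) = ! s v := by
  choose f hf using h
  let ρ : G.V → G.V := fun v =>
    (Quotient.mk (EqvGen.setoid (G.step B)) v).out
  refine ⟨fun v => f (ρ v) v, fun i hi v => ?_⟩
  have h1 : ρ (G.inv i v) = ρ v := by
    have : Quotient.mk (EqvGen.setoid (G.step B)) (G.inv i v) = Quotient.mk _ v :=
      Quotient.sound (EqvGen.symm _ _ (EqvGen.rel _ _ ⟨i, hi, rfl⟩))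
    simp only [ρ, this]
  have h2 : EqvGen (G.step B) (ρ v) v := Quotient.mk_out (s := EqvGen.setoid (G.step B)) v
  beta_reduce
  rw [h1]
  exact hf _ v h2 i hi

theorem rho_ge_one [NeZero n] (G : CG n) (hn : 3 ≤ n) (hG : G.Connected) (hnb : ¬ G.Bipartite)
    (h3 : ∀ B : Finset (Fin n), B.card = 3 → ∀ v, G.ResidueBipartite (↑B) v)
    (ε : ZMod n ≃ Fin n) : 1 ≤ G.rho ε := by
  classical
  have hex : ∀ a b c : Fin n, ∃ s : G.V → Bool, (∀ v, s (G.inv a v) = ! s v) ∧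
      (∀ v, s (G.inv b v) = ! s v) ∧ (∀ v, s (G.inv c v) = ! s v) := by
    intro a b c
    obtain ⟨B, hB, hc⟩ := Finset.exists_superset_card_eq (s := ({a, b, c} : Finset (Fin n)))
      (n := 3) Finset.card_le_three (by simpa using hn)
    obtain ⟨s, hs⟩ := glue G (B : Set (Fin n)) (h3 B hc)
    exact ⟨s, hs a (hB (by simp)), hs b (hB (by simp)), hs c (hB (by simp))⟩
  choose s hs using fun j => hex (ε j) (ε (j + 1)) (ε j)
  have hb := face_bound G hG hnb ε ε.surjective s (fun j => (hs j).1) (fun j => (hs j).2.1)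
  set P := Nat.card {v // s 0 v = true} with hP
  have hV : 2 * P = Nat.card G.V := card_black G (s 0) (ε 0) (hs 0).1
  have htri : ∀ a b c, Even (G.g {a, b} + G.g {b, c} + G.g {c, a} + 3 * P) := by
    intro a b c
    obtain ⟨t, h1, h2, h3⟩ := hex a b c
    have h := triangle G t a b c h1 h2 h3
    have hp := card_black G t a h1
    have : Nat.card {v // t v = true} = P := by omega
    rwa [this] at h
  let F : Fin n → Fin n → ZMod 2 := fun a b => (G.g {a, b} : ZMod 2) + P
  have hF : ∀ a b c, F a b + F b c + F c a = 0 := by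
    intro a b c
    have := (ZMod.natCast_eq_zero_iff_even).2 (htri a b c)
    push_cast at this
    simp only [F]
    linear_combination this
  have hsymm : ∀ a b, F a b = F b a := by
    intro a b
    simp only [F, Set.pair_comm]
  have hsum : ∑ j : ZMod n, F (ε j) (ε (j + 1)) = 0 := by
    have hx : ∀ j : ZMod n, F (ε j) (ε (j + 1)) = F (ε 0) (ε j) + F (ε 0) (ε (j + 1)) := by
      intro j
      have h1 := hF (ε j) (ε (j + 1)) (ε 0)
      rw [hsymm (ε (j + 1)) (ε 0), add_assoc] at h1
      rw [eq_neg_of_add_eq_zero_left h1, ZMod.neg_eq_self_mod_two, add_comm]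
    rw [Finset.sum_congr rfl (fun j _ => hx j), Finset.sum_add_distrib]
    have hsh : ∑ j : ZMod n, F (ε 0) (ε (j + 1)) = ∑ j : ZMod n, F (ε 0) (ε j) :=
      Equiv.sum_comp (Equiv.addRight (1 : ZMod n)) (fun j => F (ε 0) (ε j))
    rw [hsh]
    exact CharTwo.add_self_eq_zero _
  set S := ∑ j : ZMod n, G.g {ε j, ε (j + 1)} with hS
  have hev : Even (S + n * P) := by
    rw [← ZMod.natCast_eq_zero_iff_even, ← hsum]
    simp [F, hS, Finset.sum_add_distrib, ZMod.card]
  rw [← hV] at hb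
  have hb2 : S + 2 * P ≤ n * P := by
    have : n * (2 * P) = 2 * (n * P) := by ring
    rw [this] at hb
    obtain ⟨k, hk⟩ := hev
    omega
  have hpQ : G.pQ = P := by
    rw [pQ, ← hV]; push_cast; ring
  have hSq : (∑ j : ZMod n, (G.g {ε j, ε (j + 1)} : ℚ)) = S := by rw [hS]; push_cast; rfl
  rw [rho, hpQ, hSq]
  have hb3 : (S : ℚ) + 2 * P ≤ n * P := by exact_mod_cast hb2
  linarith

end CG
/-- a non-bipartite `(d+1)`-colored graph whose 3-residues are all
bipartite and whose `d`-residues are bipartite or non-bipartite with integer regular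
genus with respect to every cyclic permutation satisfies `ω_G(Γ) ≥ d!/2`. -/
theorem omegaG_ge_half_factorial {d : ℕ} [NeZero d] (G : CG (d + 1)) (hG : G.Connected)
    (hnb : ¬ G.Bipartite)
    (h3 : ∀ B : Finset (Fin (d + 1)), B.card = 3 → ∀ v, G.ResidueBipartite (↑B) v)
    (hres : ∀ (i : Fin (d + 1)) (v : G.V), (G.hatRes i v).Bipartite ∨
      (¬ (G.hatRes i v).Bipartite ∧
        ∀ ε' : ZMod d ≃ Fin d, ∃ k : ℤ, (G.hatRes i v).rho ε' = (k : ℚ))) :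
    ((d.factorial : ℚ)) / 2 ≤ G.omegaG := by
  have hd : d ≠ 0 := NeZero.ne d
  have hd2 : 2 ≤ d := by
    by_contra hlt
    have hd1 : d = 1 := by omega
    subst hd1
    exact hnb (CG.bip_two G hG)
  have hrho : ∀ ε, 1 ≤ G.rho ε := CG.rho_ge_one G (by omega) hG hnb h3
  have hsum := Finset.card_nsmul_le_sum (Finset.univ : Finset (ZMod (d + 1) ≃ Fin (d + 1)))
    (fun ε => G.rho ε) 1 (fun ε _ => hrho ε)
  obtain ⟨e0⟩ := (inferInstance : Nonempty (ZMod (d + 1) ≃ Fin (d + 1)))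
  rw [Finset.card_univ, Fintype.card_equiv e0, ZMod.card, Nat.factorial_succ, nsmul_eq_mul,
    mul_one] at hsum
  rw [CG.omegaG, le_div_iff₀ (by positivity)]
  refine le_trans (le_of_eq ?_) hsum
  push_cast
  ring
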